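/- For all Γ̂ ∈ [0, 0.49], δ ∈ [0, δ_max] and h ∈ ℝ: A(Γ̂;δ) + B(Γ̂;δ)·cos h + C(Γ̂;δ)·cos 2h > 0, where A(Γ̂;δ) = (1+2Γ̂)·(1 + δ·U00/2), B(Γ̂;δ) = (2δ/3)·U10·(1 − 4Γ̂ − 4Γ̂²)/√((1−2Γ̂)(3+2Γ̂)), C(Γ̂;δ) = −(δ/6)·U20·(1+2Γ̂). Equivalently, ∂Ĥ_CP/∂Γ̂(Γ̂,h;δ) = −12·(A(Γ̂;δ) + B(Γ̂;δ)·cos h + C(Γ̂;δ)·cos 2h) < 0. -/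

import Mathlib

noncomputable section
open Real Set

namespace Secular

def U00 : ℝ := 0.762646
def U10 : ℝ := 0.547442
def U20 : ℝ := 0.237353
def mC : ℝ := (-4 + Real.sqrt 21) / 5
def rhoC : ℝ := 1.762157978551987e-18
def muC : ℝ := 398600.44
def aM : ℝ := 384400
def aMin : ℝ := 6378.14
def aMax : ℝ := 30000
def Lmin : ℝ := Real.sqrt (muC * aMin)
def Lmax : ℝ := Real.sqrt (muC * aMax)
def deltaFun (L : ℝ) : ℝ := rhoC * L ^ 10 / (muC ^ 3 * aM ^ 3)
def deltaMax : ℝ := deltaFun Lmax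
def rho0 : ℝ := muC ^ 4 * 1.08e-3 * 6378.14 ^ 2
def rho1 : ℝ := rhoC * rho0
def alphaCube (L : ℝ) : ℝ := L ^ 6 / (muC ^ 3 * aM ^ 3)

def aA (σ : ℝ) : ℝ := 1 - 16 * σ - 20 * σ ^ 2
def bB (σ : ℝ) : ℝ := (2 * σ + 3) * Real.sqrt (3 - 4 * σ - 4 * σ ^ 2)
def cPl (σ : ℝ) : ℝ := U00 / 2 * aA σ + 5 * U10 / 3 * bB σ
def cMi (σ : ℝ) : ℝ := U00 / 2 * aA σ - 5 * U10 / 3 * bB σ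
def Ap (σ δ : ℝ) : ℝ := aA σ + δ * cPl σ
def Am (σ δ : ℝ) : ℝ := aA σ + δ * cMi σ


def Afun (Γh δ : ℝ) : ℝ := (1 + 2*Γh) * (1 + δ * U00 / 2)
def Bfun (Γh δ : ℝ) : ℝ :=
  (2*δ/3) * U10 * (1 - 4*Γh - 4*Γh^2) / Real.sqrt ((1 - 2*Γh) * (3 + 2*Γh))
def Cfun (Γh δ : ℝ) : ℝ := -(δ/6) * U20 * (1 + 2*Γh)

/-- Rescaled coplanar secular Hamiltonian at circular motions `ξ = η = 0`. -/
def HCPhat (Γh h δ : ℝ) : ℝ :=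
  (1 - 12*Γh - 12*Γh^2) * (1 + δ * U00 / 2)
  - 2 * δ * U10 * (2*Γh + 1) * Real.sqrt ((1 - 2*Γh) * (3 + 2*Γh)) * Real.cos h
  - (δ * U20 / 2) * (1 - 2*Γh) * (3 + 2*Γh) * Real.cos (2*h)

theorem deltaMax_le : deltaMax ≤ 0.12 := by
  have hsq : Lmax ^ 2 = muC * aMax :=
    Real.sq_sqrt (by norm_num [muC, aMax])
  have hpow : Lmax ^ 10 = (muC * aMax) ^ 5 := by
    rw [← hsq]; ring
  rw [deltaMax, deltaFun, hpow]
  norm_num [rhoC, muC, aM, aMax]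

theorem hasDerivAt_HCPhat {Γh : ℝ} (hpos : 0 < (1 - 2*Γh) * (3 + 2*Γh)) (h δ : ℝ) :
    HasDerivAt (fun t => HCPhat t h δ)
      (-12 * (Afun Γh δ + Bfun Γh δ * Real.cos h + Cfun Γh δ * Real.cos (2*h))) Γh := by
  have hid : HasDerivAt (fun t : ℝ => t) 1 Γh := hasDerivAt_id Γh
  have h₁ : HasDerivAt (fun t : ℝ => 1 - 2*t) (-2) Γh := by
    simpa using (hid.const_mul 2).const_sub 1
  have h₂ : HasDerivAt (fun t : ℝ => 3 + 2*t) 2 Γh := by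
    simpa using (hid.const_mul 2).const_add 3
  have h₃ : HasDerivAt (fun t : ℝ => 2*t + 1) 2 Γh := by
    simpa using (hid.const_mul 2).add_const 1
  have h₄ : HasDerivAt (fun t : ℝ => 1 - 12*t - 12*t^2) (-12 - 24*Γh) Γh := by
    refine (((hid.const_mul 12).const_sub 1).fun_sub ((hid.fun_pow 2).const_mul 12)).congr_deriv ?_
    norm_num; ring
  have h₅ := (h₁.fun_mul h₂).sqrt hpos.ne'
  have hderiv := ((h₄.mul_const (1 + δ * U00 / 2)).fun_sub
    (((h₃.const_mul (2 * δ * U10)).fun_mul h₅).mul_const (Real.cos h))).fun_sub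
    (((h₁.const_mul (δ * U20 / 2)).fun_mul h₂).mul_const (Real.cos (2*h)))
  refine hderiv.congr_deriv ?_
  have hs : Real.sqrt ((1 - 2*Γh) * (3 + 2*Γh)) ≠ 0 := (Real.sqrt_pos.2 hpos).ne'
  have hs2 := Real.sq_sqrt hpos.le
  unfold Afun Bfun Cfun
  generalize Real.sqrt ((1 - 2*Γh) * (3 + 2*Γh)) = s at hs hs2 ⊢
  field_simp
  linear_combination (-144 * δ * U10 * Real.cos h) * hs2

theorem abs_Bfun_le {Γh δ : ℝ} (hΓ : Γh ∈ Set.Icc (0:ℝ) 0.49) (hδ : δ ∈ Set.Icc (0:ℝ) 0.12) :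
    |Bfun Γh δ| ≤ 0.32 := by
  obtain ⟨hΓ0, hΓ1⟩ := hΓ
  obtain ⟨hδ0, hδ1⟩ := hδ
  have hs : 0.28 ≤ Real.sqrt ((1 - 2*Γh) * (3 + 2*Γh)) :=
    Real.le_sqrt_of_sq_le (by nlinarith)
  have hnum : |1 - 4*Γh - 4*Γh^2| ≤ 1.93 := abs_le.2 ⟨by nlinarith, by nlinarith⟩
  have hcoef : 0 ≤ (2*δ/3) * U10 := by unfold U10; positivity
  have hcoef' : (2*δ/3) * U10 ≤ 0.044 := by unfold U10; linarith
  rw [Bfun, abs_div, abs_mul, abs_of_nonneg hcoef, abs_of_nonneg (Real.sqrt_nonneg _),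
    div_le_iff₀ (by linarith)]
  calc (2*δ/3) * U10 * |1 - 4*Γh - 4*Γh^2| ≤ 0.044 * 1.93 := by gcongr
    _ ≤ 0.32 * Real.sqrt ((1 - 2*Γh) * (3 + 2*Γh)) := by linarith

theorem abs_Cfun_le {Γh δ : ℝ} (hΓ : Γh ∈ Set.Icc (0:ℝ) 0.49) (hδ : δ ∈ Set.Icc (0:ℝ) 0.12) :
    |Cfun Γh δ| ≤ 0.01 := by
  obtain ⟨hΓ0, hΓ1⟩ := hΓ
  obtain ⟨hδ0, hδ1⟩ := hδ
  have hprod : δ * (1 + 2*Γh) ≤ 0.12 * 1.98 := by gcongr; linarith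
  have hprod0 : 0 ≤ δ * (1 + 2*Γh) := by positivity
  unfold Cfun U20
  exact abs_le.2 ⟨by linarith, by linarith⟩

theorem one_le_Afun {Γh δ : ℝ} (hΓ : 0 ≤ Γh) (hδ : 0 ≤ δ) : 1 ≤ Afun Γh δ := by
  unfold Afun U00
  have hprod : 0 ≤ Γh * δ := mul_nonneg hΓ hδ
  linarith

theorem neg_le_mul_cos {b c : ℝ} (hb : |b| ≤ c) (x : ℝ) : -c ≤ b * Real.cos x := by
  refine (abs_le.1 ?_).1
  rw [abs_mul]
  exact (mul_le_of_le_one_right (abs_nonneg b) (Real.abs_cos_le_one x)).trans hb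

/-- for all `Γ̂ ∈ [0,0.49]`, `δ ∈ [0,δ_max]` and `h ∈ ℝ`,
`A + B·cos h + C·cos 2h > 0`; equivalently
`∂Ĥ_CP/∂Γ̂ = −12·(A + B·cos h + C·cos 2h) < 0`. -/
theorem stmt10 :
    ∀ Γh ∈ Set.Icc (0:ℝ) 0.49, ∀ δ ∈ Set.Icc (0:ℝ) deltaMax, ∀ h : ℝ,
      0 < Afun Γh δ + Bfun Γh δ * Real.cos h + Cfun Γh δ * Real.cos (2*h) ∧
      deriv (fun t => HCPhat t h δ) Γh =
        -12 * (Afun Γh δ + Bfun Γh δ * Real.cos h + Cfun Γh δ * Real.cos (2*h)) ∧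
      deriv (fun t => HCPhat t h δ) Γh < 0 := by
  intro Γh hΓ δ hδ h
  have hδ' : δ ∈ Set.Icc (0:ℝ) 0.12 := ⟨hδ.1, hδ.2.trans deltaMax_le⟩
  have hpos : 0 < Afun Γh δ + Bfun Γh δ * Real.cos h + Cfun Γh δ * Real.cos (2*h) := by
    have hA := one_le_Afun hΓ.1 hδ.1
    have hB := neg_le_mul_cos (abs_Bfun_le hΓ hδ') h
    have hC := neg_le_mul_cos (abs_Cfun_le hΓ hδ') (2*h)
    linarith
  have hrad : 0 < (1 - 2*Γh) * (3 + 2*Γh) :=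
    mul_pos (by linarith [hΓ.2]) (by linarith [hΓ.1])
  have hderiv := (hasDerivAt_HCPhat hrad h δ).deriv
  exact ⟨hpos, hderiv, by rw [hderiv]; linarith⟩

end Secular
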